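/- Integration-by-parts identity underlying weighted score matching (one-dimensional case): let p_d : ℝ → ℝ be a continuously differentiable probability density with p_d(y) > 0 for all y, let s_m : ℝ → ℝ (the model score) and r : ℝ → ℝ (the weighting function) be continuously differentiable, and suppose r(y)² s_m(y) p_d(y) → 0 as y → ±∞ and the relevant integrands are integrable. Then, writing s_d = p_d'/p_d for the data score, ∫_ℝ ( −2 r(y)² s_m(y) s_d(y) ) p_d(y) dy = ∫_ℝ 2 (r² s_m)'(y) p_d(y) dy; consequently the weighted Fisher divergence satisfies ∫_ℝ ( r(y) (s_m(y) − s_d(y)) )² p_d(y) dy = ∫_ℝ [ (r(y) s_m(y))² + 2 (r² s_m)'(y) ] p_d(y) dy + ∫_ℝ (r(y) s_d(y))² p_d(y) dy, where the last term does not depend on the model. -/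

import Mathlib

open MeasureTheory Filter

/-- Integration-by-parts identity underlying weighted score matching (one-dimensional
case). Writing `s_d = p_d'/p_d` for the data score, the cross term of the weighted
Fisher divergence can be rewritten without the data score, and consequently the
weighted Fisher divergence decomposes into a model-dependent part and a part that does
not depend on the model. -/
theorem weighted_score_matching_integration_by_parts
    (pd sm r : ℝ → ℝ)
    (hpd : ContDiff ℝ 1 pd) (hpd_pos : ∀ y, 0 < pd y)
    (hpd_prob : ∫ y, pd y = 1)
    (hsm : ContDiff ℝ 1 sm) (hr : ContDiff ℝ 1 r)
    (hdecay_top : Tendsto (fun y => r y ^ 2 * sm y * pd y) atTop (nhds 0))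
    (hdecay_bot : Tendsto (fun y => r y ^ 2 * sm y * pd y) atBot (nhds 0))
    (hint1 : Integrable (fun y => (r y * sm y) ^ 2 * pd y))
    (hint2 : Integrable (fun y => deriv (fun z => r z ^ 2 * sm z) y * pd y))
    (hint3 : Integrable (fun y => (r y * (deriv pd y / pd y)) ^ 2 * pd y))
    (hint4 : Integrable (fun y => r y ^ 2 * sm y * (deriv pd y / pd y) * pd y)) :
    (∫ y, (-2 * r y ^ 2 * sm y * (deriv pd y / pd y)) * pd y
        = ∫ y, 2 * deriv (fun z => r z ^ 2 * sm z) y * pd y) ∧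
    (∫ y, (r y * (sm y - deriv pd y / pd y)) ^ 2 * pd y
        = (∫ y, ((r y * sm y) ^ 2 + 2 * deriv (fun z => r z ^ 2 * sm z) y) * pd y)
          + ∫ y, (r y * (deriv pd y / pd y)) ^ 2 * pd y) := by
  have hu : Differentiable ℝ (fun z => r z ^ 2 * sm z) :=
    ((hr.differentiable one_ne_zero).pow 2).mul (hsm.differentiable one_ne_zero)
  have hv : Differentiable ℝ pd := hpd.differentiable one_ne_zero
  have key : ∫ y, (deriv (fun z => r z ^ 2 * sm z) y * pd y
      + r y ^ 2 * sm y * (deriv pd y / pd y) * pd y) = 0 - 0 := by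
    refine integral_of_hasDerivAt_of_tendsto (f := fun y => r y ^ 2 * sm y * pd y)
      (fun x => ?_) (hint2.add hint4) hdecay_bot hdecay_top
    have h := (hu x).hasDerivAt.mul (hv x).hasDerivAt
    have e : r x ^ 2 * sm x * (deriv pd x / pd x) * pd x = r x ^ 2 * sm x * deriv pd x := by
      have := (hpd_pos x).ne'
      field_simp
    rw [e]
    exact h
  rw [integral_add hint2 hint4] at key
  have e1 : ∫ y, (-2 * r y ^ 2 * sm y * (deriv pd y / pd y)) * pd y
      = -2 * ∫ y, r y ^ 2 * sm y * (deriv pd y / pd y) * pd y := by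
    rw [← integral_const_mul]
    congr 1; funext y; ring
  have e2 : ∫ y, 2 * deriv (fun z => r z ^ 2 * sm z) y * pd y
      = 2 * ∫ y, deriv (fun z => r z ^ 2 * sm z) y * pd y := by
    rw [← integral_const_mul]
    congr 1; funext y; ring
  have e3 : ∫ y, (r y * (sm y - deriv pd y / pd y)) ^ 2 * pd y
      = (∫ y, (r y * sm y) ^ 2 * pd y)
        + (-2 * ∫ y, r y ^ 2 * sm y * (deriv pd y / pd y) * pd y)
        + ∫ y, (r y * (deriv pd y / pd y)) ^ 2 * pd y := by
    have h12 : Integrable (fun y => (r y * sm y) ^ 2 * pd y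
        + -2 * (r y ^ 2 * sm y * (deriv pd y / pd y) * pd y)) :=
      hint1.add (hint4.const_mul (-2))
    rw [← integral_const_mul, ← integral_add hint1 (hint4.const_mul (-2)),
      ← integral_add h12 hint3]
    congr 1; funext y; ring
  have e4 : ∫ y, ((r y * sm y) ^ 2 + 2 * deriv (fun z => r z ^ 2 * sm z) y) * pd y
      = (∫ y, (r y * sm y) ^ 2 * pd y)
        + 2 * ∫ y, deriv (fun z => r z ^ 2 * sm z) y * pd y := by
    rw [← integral_const_mul, ← integral_add hint1 (hint2.const_mul 2)]
    congr 1; funext y; ring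
  constructor
  · rw [e1, e2]; linarith
  · rw [e3, e4]; linarith
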